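/- The set H := {c^ℓ h_1 : ℓ ≥ 0} ∪ {c^m h_1h_2 : m ≥ 0} ∪ {c^n h_2h_1 : n ≥ 0} ∪ {c^r h_2 : r ≥ 0} is the complement in the Kauffman monoid K_3 of the submonoid C = {c^k : k ≥ 0}, and H is a two-sided ideal of K_3, namely the ideal generated by h_1 and h_2. -/

import Mathlib

open scoped Classical

/-- Generators of the Kauffman monoid `K₃`. -/
inductive K3Gen : Type
  | h1 | h2 | c
deriving DecidableEq

namespace K3Gen

/-- The defining relations of the Kauffman monoid `K₃`:
`h₁h₂h₁ = h₁`, `h₂h₁h₂ = h₂`, `h₁² = ch₁ = h₁c`, `h₂² = ch₂ = h₂c`. -/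
inductive K3Rel : FreeMonoid K3Gen → FreeMonoid K3Gen → Prop
  | braid1 : K3Rel (.of h1 * .of h2 * .of h1) (.of h1)
  | braid2 : K3Rel (.of h2 * .of h1 * .of h2) (.of h2)
  | sq1 : K3Rel (.of h1 * .of h1) (.of c * .of h1)
  | comm1 : K3Rel (.of c * .of h1) (.of h1 * .of c)
  | sq2 : K3Rel (.of h2 * .of h2) (.of c * .of h2)
  | comm2 : K3Rel (.of c * .of h2) (.of h2 * .of c)

end K3Gen

/-- The congruence on the free monoid over the generators generated by the relations. -/
def K3Con : Con (FreeMonoid K3Gen) := conGen K3Gen.K3Rel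

/-- The Kauffman monoid `K₃`. -/
def K3 : Type := K3Con.Quotient

instance : Monoid K3 := Con.monoid K3Con

namespace K3

/-- The generator `h₁` of `K₃`. -/
def h1 : K3 := K3Con.mk' (.of .h1)
/-- The generator `h₂` of `K₃`. -/
def h2 : K3 := K3Con.mk' (.of .h2)
/-- The generator `c` of `K₃`. -/
def c : K3 := K3Con.mk' (.of .c)

end K3

/-- The identity `w ≍ w'` (words over the countably infinite alphabet `ℕ`) holds in the
monoid `M` if every monoid homomorphism from the free monoid over `ℕ` to `M` equalizes
`w` and `w'`. -/
def HoldsIn (M : Type*) [Monoid M] (w w' : List ℕ) : Prop :=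
  ∀ φ : FreeMonoid ℕ →* M, φ (FreeMonoid.ofList w) = φ (FreeMonoid.ofList w')

/-- The set `C = {cᵏ : k ≥ 0}` in `K₃`. -/
def Cset : Set K3 := {x | ∃ k : ℕ, x = K3.c ^ k}

/-- The set `H = {cˡh₁} ∪ {cᵐh₁h₂} ∪ {cⁿh₂h₁} ∪ {cʳh₂}` in `K₃`. -/
def Hset : Set K3 :=
  {x | ∃ l : ℕ, x = K3.c ^ l * K3.h1} ∪ {x | ∃ m : ℕ, x = K3.c ^ m * K3.h1 * K3.h2} ∪
    {x | ∃ n : ℕ, x = K3.c ^ n * K3.h2 * K3.h1} ∪ {x | ∃ r : ℕ, x = K3.c ^ r * K3.h2}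

/-- A subset `I` of a monoid `M` is a two-sided ideal if `MIM ⊆ I`. -/
def IsIdeal {M : Type*} [Monoid M] (I : Set M) : Prop :=
  ∀ ⦃x⦄, x ∈ I → ∀ a b : M, a * x * b ∈ I

namespace K3

theorem rel_eq {a b : FreeMonoid K3Gen} (h : K3Gen.K3Rel a b) :
    K3Con.mk' a = K3Con.mk' b :=
  (Con.eq K3Con).2 (ConGen.Rel.of _ _ h)

theorem b1 : h1 * h2 * h1 = h1 := rel_eq .braid1
theorem b2 : h2 * h1 * h2 = h2 := rel_eq .braid2
theorem s1 : h1 * h1 = c * h1 := rel_eq .sq1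
theorem s2 : h2 * h2 = c * h2 := rel_eq .sq2
theorem c1 : c * h1 = h1 * c := rel_eq .comm1
theorem c2 : c * h2 = h2 * c := rel_eq .comm2

theorem p1 (k : ℕ) : h1 * c ^ k = c ^ k * h1 :=
  ((show Commute c h1 from c1).pow_left k).eq.symm
theorem p2 (k : ℕ) : h2 * c ^ k = c ^ k * h2 :=
  ((show Commute c h2 from c2).pow_left k).eq.symm

theorem ind {P : K3 → Prop} (one : P 1) (m1 : ∀ x, P x → P (h1 * x))
    (m2 : ∀ x, P x → P (h2 * x)) (mc : ∀ x, P x → P (c * x)) (x : K3) : P x := by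
  obtain ⟨w, rfl⟩ := Con.mk'_surjective (c := K3Con) x
  induction w using FreeMonoid.inductionOn' with
  | one => exact one
  | of_mul g w ih =>
    cases g
    · exact m1 _ ih
    · exact m2 _ ih
    · exact mc _ ih

/-- Character sending `h₁, h₂` to `0` and `c` to `1`. -/
def chi : K3 →* ℕ :=
  Con.lift K3Con (FreeMonoid.lift (fun g => match g with
    | .h1 => 0
    | .h2 => 0
    | .c => 1)) (by
      refine Con.conGen_le.2 ?_
      intro a b h
      cases h <;> simp [Con.ker_rel])

theorem chi_h1 : chi h1 = 0 := rfl
theorem chi_h2 : chi h2 = 0 := rfl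
theorem chi_c : chi c = 1 := rfl

theorem mem_iff (x : K3) : x ∈ Hset ↔ ∃ k : ℕ, x = c ^ k * h1 ∨ x = c ^ k * (h1 * h2) ∨
    x = c ^ k * (h2 * h1) ∨ x = c ^ k * h2 := by
  simp only [Hset, Set.mem_union, Set.mem_ofPred_eq, mul_assoc, exists_or, or_assoc]

theorem h1_left {x : K3} (hx : x ∈ Hset) : h1 * x ∈ Hset := by
  rw [mem_iff] at *
  obtain ⟨k, rfl | rfl | rfl | rfl⟩ := hx
  · exact ⟨k + 1, .inl (by rw [← mul_assoc, p1, mul_assoc, s1, pow_succ, mul_assoc])⟩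
  · exact ⟨k + 1, .inr (.inl (by
      rw [← mul_assoc, p1, mul_assoc, ← mul_assoc h1 h1, s1, pow_succ]; simp only [mul_assoc]))⟩
  · exact ⟨k, .inl (by rw [← mul_assoc, p1, mul_assoc, ← mul_assoc h1 h2, b1])⟩
  · exact ⟨k, .inr (.inl (by rw [← mul_assoc, p1, mul_assoc]))⟩

theorem h2_left {x : K3} (hx : x ∈ Hset) : h2 * x ∈ Hset := by
  rw [mem_iff] at *
  obtain ⟨k, rfl | rfl | rfl | rfl⟩ := hx
  · exact ⟨k, .inr (.inr (.inl (by rw [← mul_assoc, p2, mul_assoc])))⟩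
  · exact ⟨k, .inr (.inr (.inr (by rw [← mul_assoc, p2, mul_assoc, ← mul_assoc h2 h1, b2])))⟩
  · exact ⟨k + 1, .inr (.inr (.inl (by
      rw [← mul_assoc, p2, mul_assoc, ← mul_assoc h2 h2, s2, pow_succ]; simp only [mul_assoc])))⟩
  · exact ⟨k + 1, .inr (.inr (.inr (by rw [← mul_assoc, p2, mul_assoc, s2, pow_succ, mul_assoc])))⟩

theorem c_left {x : K3} (hx : x ∈ Hset) : c * x ∈ Hset := by
  rw [mem_iff] at *
  obtain ⟨k, h⟩ := hx
  refine ⟨k + 1, ?_⟩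
  rcases h with rfl | rfl | rfl | rfl <;> simp [pow_succ', mul_assoc]

theorem mul_left (a : K3) : ∀ {x : K3}, x ∈ Hset → a * x ∈ Hset := by
  induction a using ind with
  | one => intro x hx; simpa using hx
  | m1 a ih => intro x hx; rw [mul_assoc]; exact h1_left (ih hx)
  | m2 a ih => intro x hx; rw [mul_assoc]; exact h2_left (ih hx)
  | mc a ih => intro x hx; rw [mul_assoc]; exact c_left (ih hx)

theorem h1_mem : h1 ∈ Hset := (mem_iff _).2 ⟨0, by simp⟩
theorem h2_mem : h2 ∈ Hset := (mem_iff _).2 ⟨0, by simp⟩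

theorem cover (x : K3) : x ∈ Cset ∨ x ∈ Hset := by
  induction x using ind with
  | one => exact .inl ⟨0, by simp⟩
  | m1 a ih =>
    rcases ih with ⟨k, rfl⟩ | h
    · exact .inr (by rw [p1]; exact mul_left _ h1_mem)
    · exact .inr (h1_left h)
  | m2 a ih =>
    rcases ih with ⟨k, rfl⟩ | h
    · exact .inr (by rw [p2]; exact mul_left _ h2_mem)
    · exact .inr (h2_left h)
  | mc a ih =>
    rcases ih with ⟨k, rfl⟩ | h
    · exact .inl ⟨k + 1, by rw [pow_succ']⟩
    · exact .inr (c_left h)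

theorem chi_H {x : K3} (hx : x ∈ Hset) : chi x = 0 := by
  rw [mem_iff] at hx
  obtain ⟨k, rfl | rfl | rfl | rfl⟩ := hx <;> simp [chi_h1, chi_h2]

theorem chi_C {x : K3} (hx : x ∈ Cset) : chi x = 1 := by
  obtain ⟨k, rfl⟩ := hx
  simp [chi_c]

theorem H_eq : Hset = Csetᶜ := by
  ext x
  constructor
  · intro h h'
    have := chi_H h
    rw [chi_C h'] at this
    exact one_ne_zero this
  · intro h
    exact (cover x).resolve_left h

theorem mem_of_chi {x : K3} (h : chi x = 0) : x ∈ Hset := by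
  refine (cover x).resolve_left fun h' => ?_
  rw [chi_C h'] at h
  exact one_ne_zero h

end K3

/-- The set `H = {cˡh₁} ∪ {cᵐh₁h₂} ∪ {cⁿh₂h₁} ∪ {cʳh₂}` is the complement in the
Kauffman monoid `K₃` of the submonoid `C = {cᵏ : k ≥ 0}`, and `H` is a two-sided ideal
of `K₃`, namely the smallest two-sided ideal containing `h₁` and `h₂`. -/
theorem Hset_eq_compl_Cset_and_isIdeal :
    Hset = Csetᶜ ∧ IsIdeal Hset ∧ K3.h1 ∈ Hset ∧ K3.h2 ∈ Hset ∧
      ∀ I : Set K3, IsIdeal I → K3.h1 ∈ I → K3.h2 ∈ I → Hset ⊆ I := by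
  refine ⟨K3.H_eq, ?_, K3.h1_mem, K3.h2_mem, ?_⟩
  · intro x hx a b
    exact K3.mem_of_chi (by simp [K3.chi_H hx])
  · intro I hI i1 i2 x hx
    rw [K3.mem_iff] at hx
    obtain ⟨k, rfl | rfl | rfl | rfl⟩ := hx
    · simpa using hI i1 (K3.c ^ k) 1
    · simpa [mul_assoc] using hI i1 (K3.c ^ k) K3.h2
    · simpa [mul_assoc] using hI i2 (K3.c ^ k) K3.h1
    · simpa using hI i2 (K3.c ^ k) 1
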